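/- arXiv:physics/0508177 — 2 statements merged into one kernel-verified Lean document; each statement's English description precedes it below -/
import Mathlib

section
/- Let α > 0 and a, b ∈ ℝ³, and set w := α·‖a − b‖. Then the two-center overlap integral of normalized 1s orbitals satisfies (α³/π)·∫_{ℝ³} e^{−α‖x−a‖}·e^{−α‖x−b‖} dx = e^{−w}·(1 + w + w²/3). -/
open MeasureTheory Filter Topology Set

lemma lint_aux (F f : ℝ → ℝ) (s : ℝ) (hd : ∀ t, HasDerivAt F (f t) t) (hp : ∀ t ∈ Ioi s, 0 ≤ f t)
    (hl : Tendsto F atTop (𝓝 0)) :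
    ∫⁻ t in Ioi s, ENNReal.ofReal (f t) = ENNReal.ofReal (- F s) := by
  have h1 := integrableOn_Ioi_deriv_of_nonneg (hd s).continuousAt.continuousWithinAt
    (fun x _ => hd x) hp hl
  have h2 := integral_Ioi_of_hasDerivAt_of_nonneg (hd s).continuousAt.continuousWithinAt
    (fun x _ => hd x) hp hl
  rw [← ofReal_integral_eq_lintegral_ofReal h1, h2, zero_sub]
  exact (ae_restrict_iff' measurableSet_Ioi).2 (Eventually.of_forall hp)

lemma key_iff (A h : ℝ) (f y : EuclideanSpace ℝ (Fin 3)) (hA : ‖f‖ < A)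
    (hh : h ^ 2 = A ^ 2 - ‖f‖ ^ 2) :
    ‖y - f‖ + ‖y + f‖ < 2 * A ↔
      A ^ 2 * ‖y‖ ^ 2 - (inner ℝ y f) ^ 2 < A ^ 2 * h ^ 2 := by
  have hp := norm_sub_sq_real y f
  have hq := norm_add_sq_real y f
  have h0 := norm_nonneg f
  have h1 := norm_nonneg (y - f)
  have h2 := norm_nonneg (y + f)
  have h3 : ‖y + f‖ ≤ ‖y - f‖ + 2 * ‖f‖ := by
    have := norm_add_le (y - f) ((2:ℝ) • f)
    rw [norm_smul] at this
    have e : y - f + (2:ℝ) • f = y + f := by rw [two_smul]; abel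
    rw [e] at this; simpa using this
  have h4 : ‖y - f‖ ≤ ‖y + f‖ + 2 * ‖f‖ := by
    have := norm_sub_le (y + f) ((2:ℝ) • f)
    rw [norm_smul] at this
    have e : y + f - (2:ℝ) • f = y - f := by rw [two_smul]; abel
    rw [e] at this; simpa using this
  set p := ‖y - f‖
  set q := ‖y + f‖
  set c := ‖f‖
  set n := ‖y‖
  set i := inner ℝ y f
  have hi : i = (q ^ 2 - p ^ 2) / 4 := by linarith
  have hn : n ^ 2 = (p ^ 2 + q ^ 2) / 2 - c ^ 2 := by linarith
  rw [hn, hi, hh]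
  have hD : 0 < 4 * A ^ 2 - (q - p) ^ 2 := by nlinarith
  have id : A ^ 2 * (A ^ 2 - c ^ 2) - (A ^ 2 * ((p ^ 2 + q ^ 2) / 2 - c ^ 2) - ((q ^ 2 - p ^ 2) / 4) ^ 2)
    = (4 * A ^ 2 - (q - p) ^ 2) * ((2 * A + (p + q)) * (2 * A - (p + q))) / 16 := by ring
  have hs : 0 < 2 * A + (p + q) := by linarith
  rw [← sub_pos (a := A ^ 2 * (A ^ 2 - c ^ 2)), id, ← sub_pos (a := 2 * A)]
  constructor
  · intro h; positivity
  · intro h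
    have := pos_of_mul_pos_right (a := (4 * A ^ 2 - (q - p) ^ 2)) (b := ((2 * A + (p + q)) * (2 * A - (p + q)))) (by linarith) hD.le
    exact pos_of_mul_pos_right this hs.le

lemma vol_aux (A : ℝ) (f : EuclideanSpace ℝ (Fin 3)) (hA : ‖f‖ < A) :
    volume {y : EuclideanSpace ℝ (Fin 3) | ‖y - f‖ + ‖y + f‖ < 2 * A}
      = ENNReal.ofReal (4 / 3 * Real.pi * (A * (A ^ 2 - ‖f‖ ^ 2))) := by
  have h0 := norm_nonneg f
  have hA0 : 0 < A := by linarith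
  have hpos : 0 < A ^ 2 - ‖f‖ ^ 2 := by nlinarith
  obtain ⟨h, hh0, hh⟩ : ∃ h : ℝ, 0 < h ∧ h ^ 2 = A ^ 2 - ‖f‖ ^ 2 :=
    ⟨√(A ^ 2 - ‖f‖ ^ 2), Real.sqrt_pos.2 hpos, Real.sq_sqrt hpos.le⟩
  obtain ⟨k, hk⟩ : ∃ k, k * (A + h) = 1 := ⟨1 / (A + h), by field_simp⟩
  have hkc : k * ‖f‖ ^ 2 = A - h := by
    have : ‖f‖ ^ 2 = (A + h) * (A - h) := by linarith
    rw [this, ← mul_assoc, hk, one_mul]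
  have hf : ‖f‖ ^ 2 = f 0 ^ 2 + f 1 ^ 2 + f 2 ^ 2 := by
    rw [EuclideanSpace.real_norm_sq_eq, Fin.sum_univ_three]
  let M : Matrix (Fin 3) (Fin 3) ℝ := !![A - k * f 0 * f 0, - k * f 0 * f 1, - k * f 0 * f 2;
    - k * f 1 * f 0, A - k * f 1 * f 1, - k * f 1 * f 2;
    - k * f 2 * f 0, - k * f 2 * f 1, A - k * f 2 * f 2]
  let L : EuclideanSpace ℝ (Fin 3) →ₗ[ℝ] EuclideanSpace ℝ (Fin 3) := Matrix.toEuclideanLin M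
  have hdet : LinearMap.det L = A ^ 2 * h := by
    have : LinearMap.det L = M.det := by
      simp only [L, Matrix.toEuclideanLin_eq_toLin_orthonormal]
      exact LinearMap.det_toLin _ _
    rw [this, Matrix.det_fin_three]
    simp [M]
    have : A ^ 2 * h = A ^ 2 * (A - k * (f 0 ^ 2 + f 1 ^ 2 + f 2 ^ 2)) := by
      rw [← hf, hkc]; ring
    rw [this]; ring
  have hL : ∀ y, L y = A • y - (k * inner ℝ y f) • f := by
    intro y
    ext i
    simp only [L, Matrix.toLpLin_apply, PiLp.inner_apply, Fin.sum_univ_three, PiLp.sub_apply, PiLp.smul_apply]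
    fin_cases i <;> simp [M, Matrix.mulVec, dotProduct, Fin.sum_univ_three] <;> ring
  have hset : {y : EuclideanSpace ℝ (Fin 3) | ‖y - f‖ + ‖y + f‖ < 2 * A}
      = L ⁻¹' Metric.ball 0 (A * h) := by
    ext y
    rw [mem_ofPred_eq, key_iff A h f y hA hh, mem_preimage, mem_ball_zero_iff,
      ← sq_lt_sq₀ (norm_nonneg _) (by positivity), hL, norm_sub_sq_real, norm_smul, norm_smul,
      inner_smul_left, inner_smul_right, mul_pow, mul_pow, mul_pow, Real.norm_eq_abs, Real.norm_eq_abs, sq_abs, sq_abs]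
    simp only [conj_trivial]
    have : A ^ 2 * ‖y‖ ^ 2 - (inner ℝ y f) ^ 2 = A ^ 2 * ‖y‖ ^ 2 - 2 * (A * (k * inner ℝ y f * inner ℝ y f)) + (k * inner ℝ y f) ^ 2 * ‖f‖ ^ 2 := by
      generalize (inner ℝ y f : ℝ) = i at *
      linear_combination (-k * i ^ 2) * hkc + i ^ 2 * hk
    rw [this]
  rw [hset, Measure.addHaar_preimage_linearMap volume (by rw [hdet]; positivity), hdet,
    EuclideanSpace.volume_ball_fin_three, ← ENNReal.ofReal_pow (by positivity), 
    ← ENNReal.ofReal_mul (by positivity), ← ENNReal.ofReal_mul (by positivity), ← hh,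
    abs_of_pos (by positivity)]
  congr 1
  field_simp

lemma exp_lim (α : ℝ) (hα : 0 < α) (n : ℕ) :
    Tendsto (fun t : ℝ => t ^ n * Real.exp (-(α * t))) atTop (𝓝 0) := by
  have := (Real.tendsto_pow_mul_exp_neg_atTop_nhds_zero n).comp
    (tendsto_id.const_mul_atTop hα)
  have h2 := this.const_mul ((α ^ n)⁻¹)
  rw [mul_zero] at h2
  refine h2.congr fun t => ?_
  simp [mul_pow]
  field_simp

theorem lint_main (α : ℝ) (hα : 0 < α)
    (a b : EuclideanSpace ℝ (Fin 3)) :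
    ∫⁻ x : EuclideanSpace ℝ (Fin 3), ENNReal.ofReal (Real.exp (-α * ‖x - a‖) * Real.exp (-α * ‖x - b‖))
     = ENNReal.ofReal (Real.pi / 6 * (Real.exp (-(α * ‖a - b‖)) * (2 * ‖a - b‖^2/α + 6 * ‖a - b‖ / α^2 + 6 / α^3))) := by
  set R := ‖a - b‖ with hR
  have hR0 : 0 ≤ R := norm_nonneg _
  have hexp : ∀ t, HasDerivAt (fun t => Real.exp (-(α * t))) (Real.exp (-(α * t)) * -(α * 1)) t :=
    fun t => (((hasDerivAt_id t).const_mul α).neg).exp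
  have hin : ∀ x : EuclideanSpace ℝ (Fin 3),
      ENNReal.ofReal (Real.exp (-α * ‖x - a‖) * Real.exp (-α * ‖x - b‖)) =
      ∫⁻ t : ℝ, {p : EuclideanSpace ℝ (Fin 3) × ℝ | ‖p.1 - a‖ + ‖p.1 - b‖ < p.2}.indicator
        (fun p => ENNReal.ofReal (α * Real.exp (-(α * p.2)))) (x, t) := by
    intro x
    have := lint_aux (fun t => - Real.exp (-(α * t))) (fun t => α * Real.exp (-(α * t)))
      (‖x - a‖ + ‖x - b‖) (fun t => (hexp t).fun_neg.congr_deriv (by ring)) (fun t _ => by positivity)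
        (by simpa using (exp_lim α hα 0).neg)
    rw [neg_neg, ← lintegral_indicator measurableSet_Ioi] at this
    rw [← Real.exp_add]
    have e : -α * ‖x - a‖ + -α * ‖x - b‖ = -(α * (‖x - a‖ + ‖x - b‖)) := by ring
    rw [e, ← this]
    rfl
  have hmeas : MeasurableSet {p : EuclideanSpace ℝ (Fin 3) × ℝ | ‖p.1 - a‖ + ‖p.1 - b‖ < p.2} :=
    measurableSet_lt (by fun_prop) (by fun_prop)
  simp_rw [hin]
  rw [lintegral_lintegral_swap (by
    refine AEMeasurable.indicator ?_ hmeas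
    fun_prop)]
  have hout : ∀ᵐ t : ℝ, ∫⁻ x : EuclideanSpace ℝ (Fin 3), {p : EuclideanSpace ℝ (Fin 3) × ℝ | ‖p.1 - a‖ + ‖p.1 - b‖ < p.2}.indicator
        (fun p => ENNReal.ofReal (α * Real.exp (-(α * p.2)))) (x, t) = 
        (Ioi R).indicator (fun t => ENNReal.ofReal (α * Real.exp (-(α * t)) * (Real.pi / 6 * (t ^ 3 - R ^ 2 * t)))) t := by
    refine Eventually.of_forall fun t => ?_
    have e1 : ∫⁻ x : EuclideanSpace ℝ (Fin 3), {p : EuclideanSpace ℝ (Fin 3) × ℝ | ‖p.1 - a‖ + ‖p.1 - b‖ < p.2}.indicator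
        (fun p => ENNReal.ofReal (α * Real.exp (-(α * p.2)))) (x, t) = 
        ENNReal.ofReal (α * Real.exp (-(α * t))) * volume {x : EuclideanSpace ℝ (Fin 3) | ‖x - a‖ + ‖x - b‖ < t} := by
      rw [← lintegral_indicator_const (measurableSet_lt (by fun_prop) (by fun_prop))]
      rfl
    rw [e1]
    by_cases ht : R < t
    · rw [indicator_of_mem (by exact ht), ENNReal.ofReal_mul (p := α * Real.exp (-(α * t))) (by positivity)]
      congr 1
      have hf : ‖(1/2 : ℝ) • (a - b)‖ = R / 2 := by
        rw [norm_smul, ← hR]; norm_num; ring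
      have hv := vol_aux (t / 2) ((1/2 : ℝ) • (a - b)) (by rw [hf]; linarith)
      rw [← measure_preimage_add_right volume ((1/2 : ℝ) • (a + b))] 
      convert hv using 2
      · ext y
        simp only [mem_preimage, mem_ofPred_eq]
        have e2 : y + (1/2 : ℝ) • (a + b) - a = y - (1/2 : ℝ) • (a - b) := by module
        have e3 : y + (1/2 : ℝ) • (a + b) - b = y + (1/2 : ℝ) • (a - b) := by module
        rw [e2, e3, mul_div_cancel₀ t two_ne_zero]
      · rw [hf]; ring
    · rw [indicator_of_notMem (by exact ht)]
      have : {x : EuclideanSpace ℝ (Fin 3) | ‖x - a‖ + ‖x - b‖ < t} = ∅ := by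
        ext x
        simp only [mem_ofPred_eq, mem_empty_iff_false, iff_false, not_lt]
        have := norm_sub_le (x - b) (x - a)
        rw [sub_sub_sub_cancel_left] at this
        linarith [not_lt.1 ht]
      rw [this, measure_empty, mul_zero]
  rw [lintegral_congr_ae hout, lintegral_indicator measurableSet_Ioi]
  rw [lint_aux (fun t => -(Real.pi / 6) * (Real.exp (-(α * t)) * ((t ^ 3 - R ^ 2 * t) + (3 * t ^ 2 - R ^ 2) / α + 6 * t / α ^ 2 + 6 / α ^ 3)))]
  · congr 1
    field_simp
    ring
  · intro t
    have hP : HasDerivAt (fun t : ℝ => (t ^ 3 - R ^ 2 * t) + (3 * t ^ 2 - R ^ 2) / α + 6 * t / α ^ 2 + 6 / α ^ 3)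
      ((3 * t ^ 2 - R ^ 2) + 6 * t / α + 6 / α ^ 2) t := by
      have h3 := hasDerivAt_pow 3 t
      have h2 := hasDerivAt_pow 2 t
      have h1 := hasDerivAt_id' t
      have := (((h3.fun_sub (h1.const_mul (R ^ 2))).fun_add (((h2.const_mul 3).sub_const (R ^ 2)).div_const α)).fun_add ((h1.const_mul 6).div_const (α ^ 2))).add_const (6 / α ^ 3)
      refine this.congr_deriv ?_
      norm_num
      field_simp
      ring
    refine (((hexp t).fun_mul hP).const_mul (-(Real.pi / 6))).congr_deriv ?_
    field_simp
    ring
  · intro t ht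
    have ht : R < t := ht
    have : 0 ≤ t ^ 3 - R ^ 2 * t := by
      have : t ^ 3 - R ^ 2 * t = t * (t - R) * (t + R) := by ring
      rw [this]
      have : 0 < t := by linarith
      have : 0 < t - R := by linarith
      positivity
    positivity
  · have e0 := (exp_lim α hα 0).const_mul (-(R ^ 2) / α + 6 / α ^ 3)
    have e1 := (exp_lim α hα 1).const_mul (-R ^ 2 + 6 / α ^ 2)
    have e2 := (exp_lim α hα 2).const_mul (3 / α)
    have e3 := exp_lim α hα 3
    have := (((e0.add e1).add e2).add e3).const_mul (-(Real.pi / 6))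
    simp only [mul_zero, add_zero] at this
    refine this.congr fun t => ?_
    ring

/-- Heitler–London overlap integral of two normalized 1s orbitals centered at
`a` and `b`: with `w = α‖a − b‖`,
`(α³/π)∫ e^{−α‖x−a‖} e^{−α‖x−b‖} dx = e^{−w}(1 + w + w²/3)`. -/
theorem heitler_london_overlap (α : ℝ) (hα : 0 < α)
    (a b : EuclideanSpace ℝ (Fin 3)) :
    (α^3 / Real.pi) *
        ∫ x : EuclideanSpace ℝ (Fin 3),
          Real.exp (-α * ‖x - a‖) * Real.exp (-α * ‖x - b‖)
      = Real.exp (-(α * ‖a - b‖)) *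
          (1 + α * ‖a - b‖ + (α * ‖a - b‖)^2 / 3) := by
  rw [integral_eq_lintegral_of_nonneg_ae (Eventually.of_forall fun x => by positivity)
    (by apply Continuous.aestronglyMeasurable; fun_prop), lint_main α hα, ENNReal.toReal_ofReal (by positivity)]
  have := Real.pi_pos
  field_simp
  ring
end

section
/- Let α > 0 and a, b ∈ ℝ³ with a ≠ b, and set R := ‖a − b‖. Then the two-center Coulomb integral satisfies (α³/π)·∫_{ℝ³} e^{−2α‖x−a‖}/‖x−b‖ dx = 1/R − e^{−2αR}·(α + 1/R). -/
open MeasureTheory Set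
lemma hl_polar2 (g : ℝ → ENNReal) (hg : Measurable g) :
    ∫⁻ p : ℝ × ℝ, g (p.1^2 + p.2^2) =
      ENNReal.ofReal (2 * Real.pi) * ∫⁻ ρ in Ioi (0:ℝ), ENNReal.ofReal ρ * g (ρ^2) := by
  rw [← lintegral_comp_polarCoord_symm]
  have h : ∀ p : ℝ × ℝ, ENNReal.ofReal p.1 • g ((polarCoord.symm p).1^2 + (polarCoord.symm p).2^2)
      = (fun ρ => ENNReal.ofReal ρ * g (ρ^2)) p.1 * (fun _ => (1:ENNReal)) p.2 := by
    intro p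
    have : (p.1 * Real.cos p.2)^2 + (p.1 * Real.sin p.2)^2 = p.1^2 := by
      have := Real.sin_sq_add_cos_sq p.2
      linear_combination p.1^2 * this
    simp [polarCoord, this]
  simp only [h]
  rw [polarCoord_target, Measure.volume_eq_prod, ← Measure.prod_restrict,
    lintegral_prod_mul (f := fun ρ => ENNReal.ofReal ρ * g (ρ^2)) (g := fun _ => (1:ENNReal))
      (by fun_prop) (by fun_prop), mul_comm]
  congr 1
  simp only [lintegral_const, Measure.restrict_apply_univ, Real.volume_Ioo, one_mul]
  congr 1
  ring

lemma hl_polar3 (H : ℝ → ℝ → ENNReal) (hH : Measurable (Function.uncurry H)) :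
    ∫⁻ z : ℝ, ∫⁻ ρ in Ioi (0:ℝ), H z ρ =
      ∫⁻ r in Ioi (0:ℝ), ∫⁻ θ in Ioo 0 Real.pi, ENNReal.ofReal r * H (r * Real.cos θ) (r * Real.sin θ) := by
  have h1 : ∫⁻ z : ℝ, ∫⁻ ρ in Ioi (0:ℝ), H z ρ = ∫⁻ p : ℝ × ℝ, (univ ×ˢ Ioi (0:ℝ)).indicator (Function.uncurry H) p := by
    rw [lintegral_indicator (by measurability), Measure.volume_eq_prod, ← Measure.prod_restrict,
      lintegral_prod _ hH.aemeasurable]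
    simp
  rw [h1, ← lintegral_comp_polarCoord_symm]
  have h2 : ∫⁻ r in Ioi (0:ℝ), ∫⁻ θ in Ioo 0 Real.pi, ENNReal.ofReal r * H (r * Real.cos θ) (r * Real.sin θ)
     = ∫⁻ p in Ioi (0:ℝ) ×ˢ Ioo 0 Real.pi, ENNReal.ofReal p.1 * H (p.1 * Real.cos p.2) (p.1 * Real.sin p.2) := by
    have : Measurable (fun p : ℝ × ℝ => ENNReal.ofReal p.1 * H (p.1 * Real.cos p.2) (p.1 * Real.sin p.2)) := by
      have := hH.comp (g := Function.uncurry H) (f := fun p : ℝ × ℝ => (p.1 * Real.cos p.2, p.1 * Real.sin p.2)) (by fun_prop)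
      exact (by fun_prop : Measurable (fun p : ℝ × ℝ => ENNReal.ofReal p.1)).mul this
    rw [Measure.volume_eq_prod, ← Measure.prod_restrict,
      lintegral_prod _ this.aemeasurable]
  rw [h2, ← lintegral_indicator (polarCoord.open_target.measurableSet), ← lintegral_indicator (measurableSet_Ioi.prod measurableSet_Ioo)]
  congr 1
  ext ⟨r, θ⟩
  simp only [indicator, polarCoord_target, mem_prod, mem_Ioi, mem_Ioo, mem_univ, true_and, polarCoord_symm_apply, Function.uncurry, smul_eq_mul]
  by_cases hr : 0 < r
  · by_cases h0 : 0 < θ ∧ θ < Real.pi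
    · have : 0 < r * Real.sin θ := mul_pos hr (Real.sin_pos_of_pos_of_lt_pi h0.1 h0.2)
      have h3 : -Real.pi < θ := by linarith [Real.pi_pos]
      simp [hr, h0, this, h3]
    · by_cases h4 : -Real.pi < θ ∧ θ < Real.pi
      · have h5 : θ ≤ 0 := by by_contra h; exact h0 ⟨by linarith, h4.2⟩
        have := Real.sin_nonpos_of_nonpos_of_neg_pi_le h5 h4.1.le
        have : ¬ 0 < r * Real.sin θ := by nlinarith
        simp [h0, this]
      · simp [h0, h4]
  · simp [hr]

lemma hl_e3 (G : ℝ → ℝ → ENNReal) (hG : Measurable (Function.uncurry G)) :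
    ∫⁻ x : EuclideanSpace ℝ (Fin 3), G (x 0) (x 1^2 + x 2^2) = ∫⁻ z : ℝ, ∫⁻ p : ℝ × ℝ, G z (p.1^2 + p.2^2) := by
  have h1 := (EuclideanSpace.volume_preserving_symm_measurableEquiv_toLp (Fin 3)).lintegral_comp_emb
    (MeasurableEquiv.measurableEmbedding _) (fun y : Fin 3 → ℝ => G (y 0) (y 1^2 + y 2^2))
  have h2 := (volume_preserving_piFinSuccAbove (fun _ : Fin 3 => ℝ) 0).lintegral_comp_emb
    (MeasurableEquiv.measurableEmbedding _) (fun y : ℝ × (Fin 2 → ℝ) => G y.1 ((y.2 0)^2 + (y.2 1)^2))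
  have hm : Measurable (fun y : ℝ × (Fin 2 → ℝ) => G y.1 ((y.2 0)^2 + (y.2 1)^2)) :=
    hG.comp (f := fun y : ℝ × (Fin 2 → ℝ) => (y.1, (y.2 0)^2 + (y.2 1)^2)) (by fun_prop)
  rw [Measure.volume_eq_prod, lintegral_prod _ hm.aemeasurable] at h2
  have h3 : ∀ z, ∫⁻ y : Fin 2 → ℝ, G z ((y 0)^2 + (y 1)^2) = ∫⁻ p : ℝ × ℝ, G z (p.1^2 + p.2^2) :=
    fun z => (volume_preserving_finTwoArrow ℝ).lintegral_comp_emb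
      (MeasurableEquiv.measurableEmbedding _) (fun p : ℝ × ℝ => G z (p.1^2 + p.2^2))
  simp only [h3] at h2
  exact h1.trans h2

lemma hl_sph (G : ℝ → ℝ → ENNReal) (hG : Measurable (Function.uncurry G)) :
    ∫⁻ x : EuclideanSpace ℝ (Fin 3), G (x 0) (x 1^2 + x 2^2) = 
      ENNReal.ofReal (2 * Real.pi) * ∫⁻ r in Ioi (0:ℝ), ∫⁻ θ in Ioo 0 Real.pi, 
        ENNReal.ofReal r * (ENNReal.ofReal (r * Real.sin θ) * G (r * Real.cos θ) ((r * Real.sin θ)^2)) := by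
  have hm : Measurable (Function.uncurry (fun z ρ : ℝ => ENNReal.ofReal ρ * G z (ρ^2))) := by
    have := hG.comp (g := Function.uncurry G) (f := fun p : ℝ × ℝ => (p.1, p.2^2)) (by fun_prop)
    exact (by fun_prop : Measurable (fun p : ℝ × ℝ => ENNReal.ofReal p.2)).mul this
  rw [hl_e3 G hG, ← hl_polar3 (fun z ρ => ENNReal.ofReal ρ * G z (ρ^2)) hm]
  rw [← lintegral_const_mul' _ _ ENNReal.ofReal_ne_top]
  congr 1
  ext z
  exact hl_polar2 (G z) (hG.comp (f := fun q : ℝ => (z, q)) (by fun_prop))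

lemma hl_theta (r R : ℝ) (hr : 0 < r) (hR : 0 < R) (hne : r ≠ R) :
    ∫⁻ θ in Ioo 0 Real.pi, ENNReal.ofReal (Real.sin θ / √((r * Real.cos θ - R)^2 + (r * Real.sin θ)^2))
      = ENNReal.ofReal (2 / max r R) := by
  have hpos : ∀ θ, 0 < (r * Real.cos θ - R)^2 + (r * Real.sin θ)^2 := by
    intro θ
    have h1 := Real.sin_sq_add_cos_sq θ
    have h2 := Real.cos_le_one θ
    have h3 : (r * Real.cos θ - R)^2 + (r * Real.sin θ)^2 = (r - R)^2 + 2 * (r * R) * (1 - Real.cos θ) := by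
      linear_combination r^2 * h1
    rw [h3]
    have : 0 < (r - R)^2 := by have := sub_ne_zero.mpr hne; positivity
    have : 0 ≤ 2 * (r * R) * (1 - Real.cos θ) := mul_nonneg (by positivity) (by linarith)
    linarith
  have hcont : Continuous (fun θ => Real.sin θ / √((r * Real.cos θ - R)^2 + (r * Real.sin θ)^2)) := by
    refine Continuous.div (by fun_prop) (by fun_prop) (fun θ => (Real.sqrt_pos.mpr (hpos θ)).ne')
  have hderiv : ∀ θ, HasDerivAt (fun θ => √((r * Real.cos θ - R)^2 + (r * Real.sin θ)^2) / (r * R))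
      (Real.sin θ / √((r * Real.cos θ - R)^2 + (r * Real.sin θ)^2)) θ := by
    intro θ
    have h1 : HasDerivAt (fun θ => (r * Real.cos θ - R)^2 + (r * Real.sin θ)^2) (2 * (r * R) * Real.sin θ) θ := by
      refine HasDerivAt.congr_deriv (((((Real.hasDerivAt_cos θ).const_mul r).sub_const R).pow 2).add (((Real.hasDerivAt_sin θ).const_mul r).pow 2)) ?_
      simp
      ring
    refine HasDerivAt.congr_deriv ((h1.sqrt (hpos θ).ne').div_const (r * R)) ?_
    have := (Real.sqrt_pos.mpr (hpos θ)).ne'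
    field_simp
  have hint : ∫ θ in (0:ℝ)..Real.pi, (Real.sin θ / √((r * Real.cos θ - R)^2 + (r * Real.sin θ)^2)) = 2 / max r R := by
    rw [intervalIntegral.integral_eq_sub_of_hasDerivAt (fun θ _ => hderiv θ) (hcont.intervalIntegrable _ _)]
    have e1 : (r * Real.cos Real.pi - R)^2 + (r * Real.sin Real.pi)^2 = (r + R)^2 := by simp; ring
    have e2 : (r * Real.cos 0 - R)^2 + (r * Real.sin 0)^2 = (r - R)^2 := by simp
    rw [e1, e2, Real.sqrt_sq (by positivity), Real.sqrt_sq_eq_abs]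
    rcases le_total r R with h | h
    · rw [max_eq_right h, abs_of_nonpos (by linarith)]; field_simp; ring
    · rw [max_eq_left h, abs_of_nonneg (by linarith)]; field_simp; ring
  rw [← hint, intervalIntegral.integral_of_le Real.pi_pos.le, integral_Ioc_eq_integral_Ioo,
    ofReal_integral_eq_lintegral_ofReal]
  · exact (hcont.integrableOn_Icc (a := 0) (b := Real.pi)).mono_set Ioo_subset_Icc_self
  · filter_upwards [ae_restrict_mem measurableSet_Ioo] with θ hθ
    exact div_nonneg (Real.sin_pos_of_pos_of_lt_pi hθ.1 hθ.2).le (Real.sqrt_nonneg _)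

open Filter Topology in
lemma hl_radial (c R : ℝ) (hc : 0 < c) (hR : 0 < R) :
    ∫⁻ r in Ioi (0:ℝ), ENNReal.ofReal (r^2 * Real.exp (-c * r) * (2 / max r R))
     = ENNReal.ofReal (4 / (c^3 * R) - Real.exp (-c * R) * (2 / c^2 + 4 / (c^3 * R))) := by
  have hd1 : ∀ r : ℝ, HasDerivAt (fun r => -(r^2/c + 2*r/c^2 + 2/c^3) * Real.exp (-c*r) * (2 / R)) (r^2 * Real.exp (-c*r) * (2 / R)) r := by
    intro r
    have he : HasDerivAt (fun r => Real.exp (-c*r)) (Real.exp (-c*r) * (-c)) r := by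
      simpa using ((hasDerivAt_id r).const_mul (-c)).exp
    have hp : HasDerivAt (fun r => -(r^2/c + 2*r/c^2 + 2/c^3)) (-(2*r/c + 2/c^2)) r := by
      have := (((((hasDerivAt_id r).pow 2).div_const c).add (((hasDerivAt_id r).const_mul 2).div_const (c^2))).add_const (2/c^3)).neg
      refine this.congr_deriv ?_
      simp
    refine ((hp.mul he).mul_const (2/R)).congr_deriv ?_
    field_simp
    ring
  have hd2 : ∀ r : ℝ, HasDerivAt (fun r => -(r/c + 1/c^2) * Real.exp (-c*r) * 2) (r * Real.exp (-c*r) * 2) r := by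
    intro r
    have he : HasDerivAt (fun r => Real.exp (-c*r)) (Real.exp (-c*r) * (-c)) r := by
      simpa using ((hasDerivAt_id r).const_mul (-c)).exp
    have hp : HasDerivAt (fun r => -(r/c + 1/c^2)) (-(1/c)) r := by
      have := (((hasDerivAt_id r).div_const c).add_const (1/c^2)).neg
      exact this
    refine ((hp.mul he).mul_const 2).congr_deriv ?_
    field_simp
    ring
  have ht : Tendsto (fun r => -(r/c + 1/c^2) * Real.exp (-c*r) * 2) atTop (𝓝 0) := by
    have h1 : Tendsto (fun r : ℝ => c * r) atTop atTop := tendsto_id.const_mul_atTop hc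
    have h2 := (Real.tendsto_pow_mul_exp_neg_atTop_nhds_zero 1).comp h1
    have h3 := (Real.tendsto_pow_mul_exp_neg_atTop_nhds_zero 0).comp h1
    have h4 := (h2.add h3).const_mul (-2/c^2)
    simp only [add_zero, mul_zero] at h4
    refine h4.congr (fun r => ?_)
    simp only [Function.comp, neg_mul]
    field_simp
  have i1 : ∫⁻ r in Ioc 0 R, ENNReal.ofReal (r^2 * Real.exp (-c * r) * (2 / max r R)) = ENNReal.ofReal (4 / (c^3 * R) - (R^2/c + 2*R/c^2 + 2/c^3) * Real.exp (-c*R) * (2 / R)) := by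
    have hcont : Continuous (fun r : ℝ => r^2 * Real.exp (-c*r) * (2 / R)) := by fun_prop
    have := intervalIntegral.integral_eq_sub_of_hasDerivAt (a := 0) (b := R) (fun r _ => hd1 r) (hcont.intervalIntegrable _ _)
    rw [intervalIntegral.integral_of_le hR.le] at this
    have e : 4 / (c^3 * R) - (R^2/c + 2*R/c^2 + 2/c^3) * Real.exp (-c*R) * (2 / R) = ∫ r in Ioc 0 R, r^2 * Real.exp (-c*r) * (2 / R) := by
      rw [this]; simp; field_simp; ring
    rw [e, ofReal_integral_eq_lintegral_ofReal]
    · refine setLIntegral_congr_fun measurableSet_Ioc (fun r hr => ?_)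
      simp only [max_eq_right hr.2]
    · exact (hcont.integrableOn_Icc (a := 0) (b := R)).mono_set Ioc_subset_Icc_self
    · filter_upwards with r
      positivity
  have i2 : ∫⁻ r in Ioi R, ENNReal.ofReal (r^2 * Real.exp (-c * r) * (2 / max r R)) = ENNReal.ofReal ((R/c + 1/c^2) * Real.exp (-c*R) * 2) := by
    have hnn : ∀ r ∈ Ioi R, 0 ≤ r * Real.exp (-c*r) * 2 := fun r hr => by
      have : 0 < r := hR.trans hr
      positivity
    have hi := integrableOn_Ioi_deriv_of_nonneg' (fun r _ => hd2 r) hnn ht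
    have := integral_Ioi_of_hasDerivAt_of_nonneg' (fun r _ => hd2 r) hnn ht
    have e : (R/c + 1/c^2) * Real.exp (-c*R) * 2 = ∫ r in Ioi R, r * Real.exp (-c*r) * 2 := by
      rw [this]; ring
    rw [e, ofReal_integral_eq_lintegral_ofReal hi]
    · refine setLIntegral_congr_fun measurableSet_Ioi (fun r hr => ?_)
      have h0 : 0 < r := hR.trans hr
      simp only [max_eq_left (le_of_lt (show R < r from hr))]
      congr 1
      field_simp
    · filter_upwards [ae_restrict_mem measurableSet_Ioi] with r hr using hnn r hr
  have hnn1 : 0 ≤ 4 / (c^3 * R) - (R^2/c + 2*R/c^2 + 2/c^3) * Real.exp (-c*R) * (2 / R) := by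
    have hq := Real.quadratic_le_exp_of_nonneg (show 0 ≤ c * R by positivity)
    have : Real.exp (-c*R) * Real.exp (c*R) = 1 := by rw [← Real.exp_add]; simp
    have h2 : Real.exp (-c*R) * (1 + c*R + (c*R)^2/2) ≤ 1 := by
      exact (mul_le_mul_of_nonneg_left hq (Real.exp_pos _).le).trans this.le
    have h3 : 4 / (c^3 * R) - (R^2/c + 2*R/c^2 + 2/c^3) * Real.exp (-c*R) * (2 / R) = 4 / (c^3*R) * (1 - Real.exp (-c*R) * (1 + c*R + (c*R)^2/2)) := by
      field_simp
      ring
    rw [h3]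
    exact mul_nonneg (by positivity) (by linarith)
  rw [← Ioc_union_Ioi_eq_Ioi hR.le, lintegral_union measurableSet_Ioi (by
    rw [Set.disjoint_left]; intro x hx hx2; exact absurd hx.2 (not_le.mpr hx2)), i1, i2, ← ENNReal.ofReal_add hnn1 (by positivity)]
  congr 1
  field_simp
  ring

lemma hl_main (c R : ℝ) (hc : 0 < c) (hR : 0 < R) :
    ∫⁻ x : EuclideanSpace ℝ (Fin 3),
      ENNReal.ofReal (Real.exp (-c * √((x 0)^2 + (x 1^2 + x 2^2))) / √((x 0 - R)^2 + (x 1^2 + x 2^2)))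
     = ENNReal.ofReal (2 * Real.pi) * ENNReal.ofReal (4 / (c^3 * R) - Real.exp (-c * R) * (2 / c^2 + 4 / (c^3 * R))) := by
  rw [hl_sph (fun z q => ENNReal.ofReal (Real.exp (-c * √(z^2 + q)) / √((z - R)^2 + q)))
    (by unfold Function.uncurry; fun_prop), ← hl_radial c R hc hR]
  congr 1
  refine lintegral_congr_ae ?_
  have hne : ∀ᵐ r : ℝ ∂(volume.restrict (Ioi (0:ℝ))), r ≠ R :=
    ae_restrict_of_ae (Measure.ae_ne volume R)
  filter_upwards [ae_restrict_mem measurableSet_Ioi, hne] with r hr hrR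
  have hr : 0 < r := hr
  rw [ENNReal.ofReal_mul (by positivity), ← hl_theta r R hr hR hrR,
    ← lintegral_const_mul' _ _ ENNReal.ofReal_ne_top]
  refine setLIntegral_congr_fun measurableSet_Ioo (fun θ hθ => ?_)
  have hs := Real.sin_pos_of_pos_of_lt_pi hθ.1 hθ.2
  have e : (r * Real.cos θ)^2 + (r * Real.sin θ)^2 = r^2 := by
    linear_combination r^2 * Real.sin_sq_add_cos_sq θ
  simp only [e, Real.sqrt_sq hr.le]
  rw [← ENNReal.ofReal_mul (by positivity), ← ENNReal.ofReal_mul (by positivity),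
    ← ENNReal.ofReal_mul (by positivity)]
  congr 1
  ring


/-- Heitler–London Coulomb integral: for `a ≠ b` and `R = ‖a − b‖`,
`(α³/π)∫ e^{−2α‖x−a‖}/‖x−b‖ dx = 1/R − e^{−2αR}(α + 1/R)`. -/
theorem heitler_london_coulomb (α : ℝ) (hα : 0 < α)
    (a b : EuclideanSpace ℝ (Fin 3)) (hab : a ≠ b) :
    (α^3 / Real.pi) *
        ∫ x : EuclideanSpace ℝ (Fin 3),
          Real.exp (-(2*α) * ‖x - a‖) / ‖x - b‖
      = 1 / ‖a - b‖ - Real.exp (-(2*α) * ‖a - b‖) * (α + 1 / ‖a - b‖) := by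
  have hR : 0 < ‖a - b‖ := norm_pos_iff.mpr (sub_ne_zero.mpr hab)
  set R := ‖a - b‖ with hRdef
  set w : EuclideanSpace ℝ (Fin 3) := EuclideanSpace.single 0 R with hw
  have hnw : ‖w‖ = ‖b - a‖ := by
    rw [norm_sub_rev, ← hRdef, hw]
    simp [abs_of_pos hR]
  obtain ⟨T, hT⟩ : ∃ T : EuclideanSpace ℝ (Fin 3) ≃ₗᵢ[ℝ] EuclideanSpace ℝ (Fin 3), T w = b - a :=
    ⟨_, Submodule.reflection_sub hnw⟩
  have h1 : ∫ x : EuclideanSpace ℝ (Fin 3), Real.exp (-(2*α) * ‖x - a‖) / ‖x - b‖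
      = ∫ x : EuclideanSpace ℝ (Fin 3), Real.exp (-(2*α) * ‖x‖) / ‖x - w‖ := by
    have e1 := integral_add_right_eq_self (μ := volume)
      (fun x : EuclideanSpace ℝ (Fin 3) => Real.exp (-(2*α) * ‖x - a‖) / ‖x - b‖) a
    rw [← e1]
    have e2 := T.measurePreserving.integral_comp T.toHomeomorph.measurableEmbedding
      (fun x : EuclideanSpace ℝ (Fin 3) => Real.exp (-(2*α) * ‖x + a - a‖) / ‖x + a - b‖)
    rw [← e2]
    congr 1
    ext x
    have e3 : T x + a - b = T (x - w) := by rw [map_sub, hT]; abel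
    rw [e3, add_sub_cancel_right, T.norm_map, T.norm_map]
  have h2 : ∀ x : EuclideanSpace ℝ (Fin 3), Real.exp (-(2*α) * ‖x‖) / ‖x - w‖ =
      Real.exp (-(2*α) * √((x 0)^2 + (x 1^2 + x 2^2))) / √((x 0 - R)^2 + (x 1^2 + x 2^2)) := by
    intro x
    simp [EuclideanSpace.norm_eq, Fin.sum_univ_three, hw, add_assoc]
  have hnn : 0 ≤ 4 / ((2*α)^3 * R) - Real.exp (-(2*α) * R) * (2 / (2*α)^2 + 4 / ((2*α)^3 * R)) := by
    have hq := Real.add_one_le_exp (2*α*R)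
    have hq := Real.quadratic_le_exp_of_nonneg (show 0 ≤ 2 * α * R by positivity)
    have hone : Real.exp (-(2*α)*R) * Real.exp (2*α*R) = 1 := by rw [← Real.exp_add]; simp
    have h2 : Real.exp (-(2*α)*R) * (1 + α*R) ≤ 1 := by
      refine (mul_le_mul_of_nonneg_left ?_ (Real.exp_pos _).le).trans hone.le
      have : 0 < α * R := by positivity
      nlinarith
    have h3 : 4 / ((2*α)^3 * R) - Real.exp (-(2*α) * R) * (2 / (2*α)^2 + 4 / ((2*α)^3 * R))
        = 4 / ((2*α)^3*R) * (1 - Real.exp (-(2*α)*R) * (1 + α*R)) := by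
      field_simp
      ring
    rw [h3]
    exact mul_nonneg (by positivity) (by linarith)
  rw [h1]
  simp only [h2]
  rw [integral_eq_lintegral_of_nonneg_ae (Filter.Eventually.of_forall (fun x => by positivity))
    (Measurable.aestronglyMeasurable (by fun_prop)), hl_main (2*α) R (by positivity) hR,
    ENNReal.toReal_mul, ENNReal.toReal_ofReal (by positivity), ENNReal.toReal_ofReal hnn]
  have := Real.pi_pos.ne'
  field_simp
  ring
end
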